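/- The projection π: F_n → W_n induces a bijection from R_g to T_c, where R_g is the set of elements appearing as an entry of some tuple in Red_R(g) (g = f_1⋯f_n) and T_c is the set of reflections appearing in some tuple in Red_T(c) (c = s_1⋯s_n). -/

import Mathlib

/-- The elementary Hurwitz move `σ_i` on `n`-tuples of a group `G`
(0-indexed: acts on entries `i` and `i+1`). -/
def hmove (n : ℕ) (G : Type*) [Group G] (i : ℕ) (hi : i + 1 < n)
    (g : Fin n → G) : Fin n → G := fun j =>
  if (j : ℕ) = i then g ⟨i, by omega⟩ * g ⟨i + 1, hi⟩ * (g ⟨i, by omega⟩)⁻¹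
  else if (j : ℕ) = i + 1 then g ⟨i, by omega⟩
  else g j

/-- One elementary step of the Hurwitz action. -/
def hstep (n : ℕ) (G : Type*) [Group G] (a b : Fin n → G) : Prop :=
  ∃ (i : ℕ) (hi : i + 1 < n), b = hmove n G i hi a

/-- Braid relations: generators `σ_1, …, σ_{n-1}` indexed by `Fin (n-1)`. -/
def braidRels (n : ℕ) : Set (FreeGroup (Fin (n - 1))) :=
  { r | (∃ i j : Fin (n - 1), (i : ℕ) + 1 = (j : ℕ) ∧
          r = FreeGroup.of i * FreeGroup.of j * FreeGroup.of i *
            (FreeGroup.of j * FreeGroup.of i * FreeGroup.of j)⁻¹) ∨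
        (∃ i j : Fin (n - 1), (i : ℕ) + 1 < (j : ℕ) ∧
          r = FreeGroup.of i * FreeGroup.of j * (FreeGroup.of j * FreeGroup.of i)⁻¹) }

/-- The braid group `B_n`. -/
abbrev BraidGroup (n : ℕ) := PresentedGroup (braidRels n)

/-- Relations of the universal Coxeter group: each generator squares to 1. -/
def coxRels (n : ℕ) : Set (FreeGroup (Fin n)) :=
  { r | ∃ i, r = FreeGroup.of i * FreeGroup.of i }

/-- The universal Coxeter group `W_n`. -/
abbrev UCox (n : ℕ) := PresentedGroup (coxRels n)

/-- The generator `s_i` of `W_n`. -/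
def sgen {n : ℕ} (i : Fin n) : UCox n := PresentedGroup.of i

/-- The Coxeter element `c = s_1 ⋯ s_n`. -/
def coxElt (n : ℕ) : UCox n := (List.ofFn fun i => sgen i).prod

/-- The set `T` of reflections of `W_n`: conjugates of generators. -/
def Refl (n : ℕ) : Set (UCox n) := { t | ∃ w i, t = w * sgen i * w⁻¹ }

/-- `Red_T(c)`: `n`-tuples of reflections with product `c`. -/
def RedT (n : ℕ) : Set (Fin n → UCox n) :=
  { t | (∀ i, t i ∈ Refl n) ∧ (List.ofFn t).prod = coxElt n }

/-- The set `R` of braid reflections of the free group: conjugates of generators. -/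
def Rset (n : ℕ) : Set (FreeGroup (Fin n)) :=
  { r | ∃ w i, r = w * FreeGroup.of i * w⁻¹ }

/-- `g = f_1 ⋯ f_n`. -/
def gElt (n : ℕ) : FreeGroup (Fin n) := (List.ofFn fun i => FreeGroup.of i).prod

/-- `Red_R(g)`: `n`-tuples from `R` with product `g`. -/
def RedR (n : ℕ) : Set (Fin n → FreeGroup (Fin n)) :=
  { t | (∀ i, t i ∈ Rset n) ∧ (List.ofFn t).prod = gElt n }

/-- The canonical projection `π : F_n → W_n`, `f_i ↦ s_i`. -/
def pr (n : ℕ) : FreeGroup (Fin n) →* UCox n := FreeGroup.lift fun i => sgen i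

/-- Length of an element of `W_n`: the length of its normal form. -/
noncomputable def wordLength {n : ℕ} (w : UCox n) : ℕ :=
  sInf { m | ∃ l : List (Fin n),
    List.Chain' (· ≠ ·) l ∧ l.length = m ∧ (l.map sgen).prod = w }


section LetterSystem

variable {A G : Type*} [Group G]

/-- A word is reduced with respect to the formal inversion `inv` of letters. -/
def IsRed (inv : A → A) (L : List A) : Prop := L.IsChain fun x y => y ≠ inv x

/-- The group element spelled by a word. -/
def ev (e : A → G) (L : List A) : G := (L.map e).prod

/-- The formal inverse of a word. -/
def invWord (inv : A → A) (L : List A) : List A := (L.map inv).reverse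

@[simp] lemma ev_nil (e : A → G) : ev e [] = 1 := rfl

@[simp] lemma ev_cons (e : A → G) (x : A) (L : List A) : ev e (x :: L) = e x * ev e L := by
  simp [ev]

@[simp] lemma ev_append (e : A → G) (L M : List A) : ev e (L ++ M) = ev e L * ev e M := by
  simp [ev]

/-- A group in which every element is spelled by a word, reduced words spelling pairwise distinct
elements. -/
structure LetterSystem (inv : A → A) (e : A → G) : Prop where
  inv_inv : ∀ x, inv (inv x) = x
  map_inv : ∀ x, e (inv x) = (e x)⁻¹
  ev_surj : ∀ g, ∃ L, ev e L = g
  ev_inj : ∀ L M, IsRed inv L → IsRed inv M → ev e L = ev e M → L = M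

variable {inv : A → A} {e : A → G}

lemma LetterSystem.ev_invWord (S : LetterSystem inv e) (L : List A) :
    ev e (invWord inv L) = (ev e L)⁻¹ := by
  induction L with
  | nil => simp [invWord]
  | cons x L ih =>
    have : invWord inv (x :: L) = invWord inv L ++ [inv x] := by simp [invWord]
    simp [this, ih, S.map_inv]

lemma LetterSystem.isRed_invWord (S : LetterSystem inv e) {L : List A} (h : IsRed inv L) :
    IsRed inv (invWord inv L) := by
  unfold IsRed invWord at *
  rw [List.isChain_reverse, List.isChain_map]
  refine h.imp fun x y hxy hn => hxy ?_
  rw [hn, S.inv_inv]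

/-- A word spelling a conjugate of a letter either is reduced in palindromic form, or can be
shortened. -/
lemma LetterSystem.exists_shorter (S : LetterSystem inv e) (W : List A) (a : A)
    (h : ¬ IsRed inv (W ++ a :: invWord inv W)) :
    ∃ V : List A, V.length < W.length ∧
      ev e V * e a * (ev e V)⁻¹ = ev e W * e a * (ev e W)⁻¹ := by
  by_cases hW : IsRed inv W
  · rcases List.eq_nil_or_concat W with rfl | ⟨U, b, hU⟩
    · exact absurd (by simp [IsRed, invWord]) h
    · obtain rfl : W = U ++ [b] := by simpa using hU
      have key : b = a ∨ b = inv a := by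
        by_contra! hb
        apply h
        have h2 := S.isRed_invWord hW
        have : invWord inv (U ++ [b]) = inv b :: invWord inv U := by simp [invWord]
        rw [this] at h2 ⊢
        unfold IsRed at *
        rw [List.isChain_append]
        refine ⟨hW, List.isChain_cons_cons.2 ⟨?_, h2⟩, ?_⟩
        · intro hn
          exact hb.1 (by rw [← S.inv_inv b, hn, S.inv_inv])
        · intro x hx y hy
          simp at hx hy
          subst hx hy
          intro hn
          exact hb.2 (by rw [hn, S.inv_inv])
      refine ⟨U, by simp, ?_⟩
      rcases key with rfl | rfl <;> simp [S.map_inv, mul_assoc]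
  · unfold IsRed at hW
    rw [List.isChain_iff_forall_rel_of_append_cons_cons] at hW
    push Not at hW
    obtain ⟨x, y, L, M, rfl, rfl⟩ := hW
    exact ⟨L ++ M, by simp, by simp [S.map_inv, mul_assoc]⟩

/-- No adjacent pair of palindromic conjugates `W a W⁻¹`, `V b V⁻¹` cancels a middle letter. -/
def NoCancel (inv : A → A) (p q : List A × A) : Prop :=
  ¬ (p.1 ++ [inv p.2] <+: q.1) ∧ ¬ (q.1 ++ [q.2] <+: p.1) ∧ ¬ (p.1 = q.1 ∧ q.2 = inv p.2)

lemma exists_common_prefix (L M : List A) :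
    ∃ c x y, L = c ++ x ∧ M = c ++ y ∧ ∀ u ∈ x.head?, ∀ v ∈ y.head?, u ≠ v := by
  classical
  induction L generalizing M with
  | nil => exact ⟨[], [], M, by simp⟩
  | cons a L ih =>
    cases M with
    | nil => exact ⟨[], a :: L, [], by simp⟩
    | cons b M =>
      by_cases hab : a = b
      · subst hab
        obtain ⟨c, x, y, rfl, rfl, h⟩ := ih M
        exact ⟨a :: c, x, y, by simp, by simp, h⟩
      · exact ⟨[], a :: L, b :: M, by simp [hab]⟩

/-- If no adjacent pair cancels a middle letter, the product of palindromic conjugates is spelled by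
a reduced word in which every middle letter survives. -/
lemma LetterSystem.exists_isRed_prod (S : LetterSystem inv e) (l : List (List A × A))
    (p : List A × A) (hred : ∀ q ∈ p :: l, IsRed inv (q.1 ++ q.2 :: invWord inv q.1))
    (hchain : (p :: l).IsChain (NoCancel inv)) :
    ∃ V : List A, IsRed inv (p.1 ++ p.2 :: V) ∧ l.length ≤ V.length ∧
      ev e (p.1 ++ p.2 :: V) =
        ((p :: l).map fun q => ev e q.1 * e q.2 * (ev e q.1)⁻¹).prod ∧
      (V.length = l.length → p.1 = [] → ∀ q ∈ l, q.1 = []) := by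
  induction l generalizing p with
  | nil =>
    refine ⟨invWord inv p.1, hred p (by simp), by simp, ?_, by simp⟩
    simp [S.ev_invWord, mul_assoc]
  | cons q l ih =>
    obtain ⟨V, hV, hlen, hev, hnil⟩ := ih q (fun r hr => hred r (by simp_all)) hchain.tail
    have hp := hred p (by simp)
    have hpq : NoCancel inv p q := (List.isChain_cons_cons.1 hchain).1
    obtain ⟨W, a⟩ := p
    obtain ⟨U, b⟩ := q
    obtain ⟨c, x, y, hx, hy, hxy⟩ := exists_common_prefix W U
    dsimp only at *
    subst hx hy
    have hinv : invWord inv (c ++ x) = invWord inv x ++ invWord inv c := by simp [invWord]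
    rw [hinv] at hp
    refine ⟨invWord inv x ++ (y ++ b :: V), ?_, ?_, ?_, ?_⟩
    · have h1 : IsRed inv ((c ++ x) ++ a :: invWord inv x) := by
        have : (c ++ x) ++ a :: (invWord inv x ++ invWord inv c) =
          ((c ++ x) ++ a :: invWord inv x) ++ invWord inv c := by simp
        rw [this] at hp
        exact List.IsChain.left_of_append hp
      have h2 : IsRed inv (y ++ b :: V) := by
        rw [List.append_assoc] at hV
        exact List.IsChain.right_of_append hV
      have : (c ++ x) ++ a :: (invWord inv x ++ (y ++ b :: V)) =
        ((c ++ x) ++ a :: invWord inv x) ++ (y ++ b :: V) := by simp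
      rw [this]
      refine List.IsChain.append h1 h2 ?_
      intro u hu v hv huv
      obtain ⟨n1, n2, n3⟩ := hpq
      dsimp only at n1 n2 n3
      cases x with
      | nil =>
        simp [invWord] at hu
        subst hu
        cases y with
        | nil =>
          simp at hv
          subst hv
          exact n3 ⟨by simp, huv⟩
        | cons y0 y =>
          simp at hv
          subst hv huv
          exact n1 ⟨y, by simp⟩
      | cons x0 x =>
        have hlast : c ++ x0 :: x ++ a :: invWord inv (x0 :: x) =
          (c ++ x0 :: x ++ a :: invWord inv x) ++ [inv x0] := by simp [invWord]
        rw [hlast, List.getLast?_append] at hu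
        simp at hu
        subst hu
        rw [S.inv_inv] at huv
        subst huv
        cases y with
        | nil =>
          simp at hv
          subst hv
          exact n2 ⟨x, by simp⟩
        | cons y0 y =>
          simp at hv
          exact hxy v (by simp) y0 (by simp) hv.symm
    · simp
      omega
    · rw [List.map_cons, List.prod_cons, ← hev]
      simp [S.ev_invWord, mul_assoc]
    · intro h1 h2
      simp [invWord] at h1
      have hx : x = [] := List.length_eq_zero_iff.1 (by omega)
      have hy : y = [] := List.length_eq_zero_iff.1 (by omega)
      subst hx hy
      have := hnil (by omega) (by simpa using h2)
      simpa using ⟨by simpa using h2, fun a b => this (a, b)⟩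

end LetterSystem

section BraidAutomorphisms

open FreeGroup

variable {n : ℕ}

/-- The endomorphism `f_i ↦ f_i f_j f_i⁻¹`, `f_j ↦ f_i` of the free group. -/
def braidHom (i j : Fin n) : FreeGroup (Fin n) →* FreeGroup (Fin n) :=
  lift fun k => if k = i then of i * of j * (of i)⁻¹ else if k = j then of i else of k

/-- The endomorphism `f_i ↦ f_j`, `f_j ↦ f_j⁻¹ f_i f_j` of the free group. -/
def braidInvHom (i j : Fin n) : FreeGroup (Fin n) →* FreeGroup (Fin n) :=
  lift fun k => if k = i then of j else if k = j then (of j)⁻¹ * of i * of j else of k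

lemma braidHom_of (i j k : Fin n) : braidHom i j (of k) =
    if k = i then of i * of j * (of i)⁻¹ else if k = j then of i else of k := by
  simp [braidHom]

lemma braidInvHom_of (i j k : Fin n) : braidInvHom i j (of k) =
    if k = i then of j else if k = j then (of j)⁻¹ * of i * of j else of k := by
  simp [braidInvHom]

/-- The Artin automorphism of the free group attached to two distinct generators. -/
def braidAut (i j : Fin n) (h : i ≠ j) : MulAut (FreeGroup (Fin n)) :=
  MonoidHom.toMulEquiv (braidHom i j) (braidInvHom i j)
    (by
      ext k
      have h' := h.symm
      by_cases h1 : k = i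
      · subst h1; simp [braidHom_of, braidInvHom_of, h', mul_assoc]
      · by_cases h2 : k = j
        · subst h2; simp [braidHom_of, braidInvHom_of, h']
        · simp [braidHom_of, braidInvHom_of, h1, h2])
    (by
      ext k
      have h' := h.symm
      by_cases h1 : k = i
      · subst h1; simp [braidHom_of, braidInvHom_of, h']
      · by_cases h2 : k = j
        · subst h2; simp [braidHom_of, braidInvHom_of, h', mul_assoc]
        · simp [braidHom_of, braidInvHom_of, h1, h2])

lemma braidAut_apply (i j : Fin n) (h : i ≠ j) (x : FreeGroup (Fin n)) :
    braidAut i j h x = braidHom i j x := rfl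

lemma braidAut_inv_apply (i j : Fin n) (h : i ≠ j) (x : FreeGroup (Fin n)) :
    (braidAut i j h)⁻¹ x = braidInvHom i j x := rfl

/-- The image of the braid group in the automorphism group of the free group. -/
def braidAuts (n : ℕ) : Subgroup (MulAut (FreeGroup (Fin n))) :=
  Subgroup.closure { φ | ∃ (i j : Fin n) (h : i ≠ j), (j : ℕ) = i + 1 ∧ φ = braidAut i j h }

lemma braidAut_mem {i j : Fin n} (h : i ≠ j) (hij : (j : ℕ) = i + 1) :
    braidAut i j h ∈ braidAuts n :=
  Subgroup.subset_closure ⟨i, j, h, hij, rfl⟩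

/-- Induction principle for elements of `braidAuts n`. -/
lemma braidAuts_induction {p : MulAut (FreeGroup (Fin n)) → Prop} (one : p 1)
    (mul : ∀ φ ψ, p φ → p ψ → p (φ * ψ))
    (gen : ∀ (i j : Fin n) (h : i ≠ j), (j : ℕ) = i + 1 → p (braidAut i j h))
    (gen_inv : ∀ (i j : Fin n) (h : i ≠ j), (j : ℕ) = i + 1 → p (braidAut i j h)⁻¹)
    {φ : MulAut (FreeGroup (Fin n))} (hφ : φ ∈ braidAuts n) : p φ := by
  have hφ' : φ ∈ Submonoid.closure ({ φ | ∃ (i j : Fin n) (h : i ≠ j),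
      (j : ℕ) = i + 1 ∧ φ = braidAut i j h } ∪ { φ | ∃ (i j : Fin n) (h : i ≠ j),
      (j : ℕ) = i + 1 ∧ φ = braidAut i j h }⁻¹) := by
    rw [← Subgroup.closure_toSubmonoid]
    exact hφ
  induction hφ' using Submonoid.closure_induction with
  | mem x hx =>
    rcases hx with ⟨i, j, h, hij, rfl⟩ | ⟨i, j, h, hij, hx⟩
    · exact gen i j h hij
    · rw [inv_eq_iff_eq_inv.1 hx]
      exact gen_inv i j h hij
  | one => exact one
  | mul x y hx hy px py =>
    rw [← Subgroup.closure_toSubmonoid] at hx hy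
    exact mul x y (px hx) (py hy)

lemma prod_ofFn_eq_of_adjacent {G : Type*} [Group G] {m : ℕ} (t t' : Fin m → G) (i j : Fin m)
    (hij : (j : ℕ) = i + 1) (hmul : t i * t j = t' i * t' j)
    (hne : ∀ k, k ≠ i → k ≠ j → t k = t' k) : (List.ofFn t).prod = (List.ofFn t').prod := by
  induction m with
  | zero => exact i.elim0
  | succ m ih =>
    rw [List.ofFn_succ, List.ofFn_succ, List.prod_cons, List.prod_cons]
    cases i using Fin.cases with
    | zero =>
      cases m with
      | zero => omega
      | succ m =>
        obtain rfl : j = 1 := by ext; simpa using hij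
        rw [List.ofFn_succ, List.ofFn_succ, List.prod_cons, List.prod_cons, ← mul_assoc,
          ← mul_assoc]
        have htail : ∀ k : Fin m, t k.succ.succ = t' k.succ.succ := fun k =>
          hne _ (Fin.succ_ne_zero _) (by simp [Fin.ext_iff])
        simp only [htail]
        congr 1
    | succ i =>
      cases j using Fin.cases with
      | zero => simp at hij
      | succ j =>
        rw [hne 0 (Fin.succ_ne_zero _).symm (Fin.succ_ne_zero _).symm]
        congr 1
        refine ih (fun k => t k.succ) (fun k => t' k.succ) i j (by simpa using hij) hmul ?_
        intro k h1 h2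
        exact hne _ (by simpa using h1) (by simpa using h2)

lemma map_gElt {G : Type*} [Group G] (θ : FreeGroup (Fin n) →* G) :
    θ (gElt n) = (List.ofFn fun i => θ (of i)).prod := by
  rw [gElt, map_list_prod, List.map_ofFn]
  rfl

lemma braidAuts_gElt {φ : MulAut (FreeGroup (Fin n))} (hφ : φ ∈ braidAuts n) :
    φ (gElt n) = gElt n := by
  have gen : ∀ (i j : Fin n) (h : i ≠ j), (j : ℕ) = i + 1 →
      braidAut i j h (gElt n) = gElt n := by
    intro i j h hij
    rw [braidAut_apply, map_gElt, gElt]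
    apply prod_ofFn_eq_of_adjacent _ _ i j hij
    · simp [braidHom_of, h.symm]
    · intro k h1 h2
      simp [braidHom_of, h1, h2]
  refine braidAuts_induction (p := fun φ => φ (gElt n) = gElt n) rfl ?_ gen ?_ hφ
  · intro φ ψ h1 h2
    rw [MulAut.mul_apply, h2, h1]
  · intro i j h hij
    rw [MulAut.inv_apply, MulEquiv.symm_apply_eq, gen i j h hij]

lemma surjective_of_sum_single (a : Fin n → Fin n)
    (h : ∑ i, (Pi.single (a i) 1 : Fin n → ZMod 2) = ∑ i, Pi.single i 1) :
    Function.Surjective a := by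
  intro k
  by_contra! hk
  have := congrFun h k
  simp [Finset.sum_apply, Pi.single_apply] at this
  have hk' : ∀ i, ¬ k = a i := fun i hi => hk i hi.symm
  simp [hk'] at this

lemma sum_lt_sum_of_eq_off {f f' : Fin n → ℕ} {i j : Fin n} (hij : i ≠ j)
    (hlt : f' i + f' j < f i + f j) (hne : ∀ k, k ≠ i → k ≠ j → f' k = f k) :
    ∑ k, f' k < ∑ k, f k := by
  have hj : j ∈ Finset.univ.erase i := by simp [hij.symm]
  have split : ∀ h : Fin n → ℕ, ∑ k, h k =
      h i + (h j + ∑ k ∈ (Finset.univ.erase i).erase j, h k) := fun h => by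
    rw [Finset.add_sum_erase _ _ hj, Finset.add_sum_erase _ _ (Finset.mem_univ i)]
  have hrest : ∑ k ∈ (Finset.univ.erase i).erase j, f' k =
      ∑ k ∈ (Finset.univ.erase i).erase j, f k :=
    Finset.sum_congr rfl fun k hk => hne k (by simp_all) (by simp_all)
  rw [split f, split f', hrest]
  omega

end BraidAutomorphisms

section Transitivity

open FreeGroup

variable {A G : Type*} [Group G] {inv : A → A} {e : A → G} {n : ℕ}

/-- Among homomorphisms from the free group sending every generator to a conjugate of a letter, those
agreeing with `ψ` on `f_1 ⋯ f_n` form a single orbit of the braid automorphisms. -/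
lemma LetterSystem.exists_braidAut_of_words (S : LetterSystem inv e) (pos : Fin n → A)
    (hpos : ∀ i j, i ≠ j → pos j ≠ inv (pos i))
    (χ : G →* Multiplicative (Fin n → ZMod 2))
    (hχ : ∀ i, χ (e (pos i)) = Multiplicative.ofAdd (Pi.single i 1))
    (ψ : FreeGroup (Fin n) →* G) (hψ : ∀ i, ψ (of i) = e (pos i)) (N : ℕ)
    (θ : FreeGroup (Fin n) →* G) (W : Fin n → List A) (a : Fin n → Fin n)
    (hθ : ∀ i, θ (of i) = ev e (W i) * e (pos (a i)) * (ev e (W i))⁻¹)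
    (hN : ∑ i, (W i).length = N) (hg : θ (gElt n) = ψ (gElt n)) :
    ∃ φ ∈ braidAuts n, ∀ x, θ x = ψ (φ x) := by
  classical
  induction N using Nat.strong_induction_on generalizing θ W a with
  | _ N ih =>
  subst hN
  by_cases hred : ∀ i, IsRed inv (W i ++ pos (a i) :: invWord inv (W i))
  swap
  · push Not at hred
    obtain ⟨i, hi⟩ := hred
    obtain ⟨V, hV, hVe⟩ := S.exists_shorter _ _ hi
    refine ih _ ?_ θ (Function.update W i V) a ?_ rfl hg
    · refine Finset.sum_lt_sum (fun k _ => ?_) ⟨i, Finset.mem_univ i, by simpa using hV⟩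
      by_cases hk : k = i
      · subst hk; simpa using hV.le
      · simp [hk]
    · intro k
      by_cases hk : k = i
      · subst hk; simpa [hVe] using hθ k
      · simpa [hk] using hθ k
  have hinj : Function.Injective a := by
    rw [Finite.injective_iff_surjective]
    apply surjective_of_sum_single
    have h := congrArg χ hg
    rw [map_gElt, map_gElt, map_list_prod, map_list_prod, List.map_ofFn, List.map_ofFn,
      List.prod_ofFn, List.prod_ofFn] at h
    have h1 : ∀ i, χ (θ (of i)) = Multiplicative.ofAdd (Pi.single (a i) 1) := fun i => by
      rw [hθ, MonoidHom.map_mul, MonoidHom.map_mul, hχ, MonoidHom.map_inv, mul_comm, ← mul_assoc,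
        inv_mul_cancel, one_mul]
    have h2 : ∀ i, χ (ψ (of i)) = Multiplicative.ofAdd (Pi.single i 1) := fun i => by rw [hψ, hχ]
    simp only [Function.comp_apply, h1, h2, ← ofAdd_sum] at h
    exact Multiplicative.ofAdd.injective h
  by_cases hL : ∃ i j : Fin n, (j : ℕ) = i + 1 ∧ W i ++ [inv (pos (a i))] <+: W j
  · obtain ⟨i, j, hij, u, hu⟩ := hL
    have hne : i ≠ j := by rintro rfl; omega
    have hlt : ∑ k, (Function.update (Function.update W i (W i ++ u)) j (W i) k).length <
        ∑ k, (W k).length := by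
      refine sum_lt_sum_of_eq_off hne ?_ ?_
      · simp [hne, ← hu]
        omega
      · intro k h1 h2
        simp [h1, h2]
    obtain ⟨φ, hφ, h⟩ := ih _ hlt (θ.comp (braidHom i j)) _
      (Function.update (Function.update a i (a j)) j (a i)) (by
        intro k
        rw [MonoidHom.comp_apply, braidHom_of]
        by_cases h1 : k = i
        · subst h1
          simp [hne, hθ, ← hu, mul_assoc, S.map_inv]
        · by_cases h2 : k = j
          · subst h2
            simp [hne.symm, hθ]
          · simp [h1, h2, hθ]) rfl (by
        rw [MonoidHom.comp_apply, ← braidAut_apply i j hne,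
          braidAuts_gElt (braidAut_mem hne hij), hg])
    refine ⟨φ * (braidAut i j hne)⁻¹, mul_mem hφ (inv_mem (braidAut_mem hne hij)), fun x => ?_⟩
    rw [MulAut.mul_apply, ← h, MonoidHom.comp_apply, ← braidAut_apply i j hne,
      MulAut.apply_inv_self]
  by_cases hR : ∃ i j : Fin n, (j : ℕ) = i + 1 ∧ W j ++ [pos (a j)] <+: W i
  · obtain ⟨i, j, hij, u, hu⟩ := hR
    have hne : i ≠ j := by rintro rfl; omega
    have hlt : ∑ k, (Function.update (Function.update W j (W j ++ u)) i (W j) k).length <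
        ∑ k, (W k).length := by
      refine sum_lt_sum_of_eq_off hne ?_ ?_
      · simp [hne.symm, ← hu]
        omega
      · intro k h1 h2
        simp [h1, h2]
    obtain ⟨φ, hφ, h⟩ := ih _ hlt (θ.comp (braidInvHom i j)) _
      (Function.update (Function.update a j (a i)) i (a j)) (by
        intro k
        rw [MonoidHom.comp_apply, braidInvHom_of]
        by_cases h1 : k = i
        · subst h1
          simp [hθ]
        · by_cases h2 : k = j
          · subst h2
            simp [hne.symm, hθ, ← hu, mul_assoc]
          · simp [h1, h2, hθ]) rfl (by
        rw [MonoidHom.comp_apply, ← braidAut_inv_apply i j hne,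
          braidAuts_gElt (inv_mem (braidAut_mem hne hij)), hg])
    refine ⟨φ * braidAut i j hne, mul_mem hφ (braidAut_mem hne hij), fun x => ?_⟩
    rw [MulAut.mul_apply, ← h, MonoidHom.comp_apply, ← braidAut_inv_apply i j hne,
      MulAut.inv_apply_self]
  push Not at hL hR
  have hpair : ∀ i j : Fin n, (j : ℕ) = i + 1 →
      NoCancel inv (W i, pos (a i)) (W j, pos (a j)) := by
    intro i j hij
    refine ⟨hL i j hij, hR i j hij, fun h => hpos (a i) (a j) (fun hn => ?_) h.2⟩
    have := hinj hn
    subst this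
    omega
  refine ⟨1, one_mem _, fun x => ?_⟩
  suffices hθψ : θ = ψ by rw [hθψ]; rfl
  have hposred : IsRed inv (List.ofFn pos) := by
    unfold IsRed
    rw [List.isChain_iff_getElem]
    intro i hi
    simp only [List.getElem_ofFn]
    exact hpos _ _ (by simp [Fin.ext_iff])
  cases n with
  | zero => ext i; exact i.elim0
  | succ n =>
    have hchain : (List.ofFn fun i => (W i, pos (a i))).IsChain (NoCancel inv) := by
      rw [List.isChain_iff_getElem]
      intro i hi
      simp only [List.getElem_ofFn]
      exact hpair _ _ rfl
    rw [List.ofFn_succ] at hchain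
    obtain ⟨V, hV, hlen, hev, hnil⟩ := S.exists_isRed_prod _ _ (by
      intro q hq
      rw [← List.ofFn_succ (f := fun i => (W i, pos (a i))), List.mem_ofFn] at hq
      obtain ⟨i, rfl⟩ := hq
      exact hred i) hchain
    rw [← List.ofFn_succ (f := fun i => (W i, pos (a i))), List.map_ofFn] at hev
    have heq : W 0 ++ pos (a 0) :: V = List.ofFn pos := by
      refine S.ev_inj _ _ hV hposred ?_
      rw [hev, ev, List.map_ofFn]
      have h := hg
      rw [map_gElt, map_gElt] at h
      simp only [hθ, hψ] at h
      exact h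
    have hcard := congrArg List.length heq
    simp only [List.length_append, List.length_cons, List.length_ofFn] at hcard hlen hnil
    have hW0 : W 0 = [] := List.length_eq_zero_iff.1 (by omega)
    have hW : ∀ i, W i = [] := by
      intro i
      cases i using Fin.cases with
      | zero => exact hW0
      | succ i =>
        exact hnil (by rw [hW0] at hcard; simpa using hcard) hW0 (W i.succ, pos (a i.succ))
          (List.mem_ofFn.2 ⟨i, rfl⟩)
    have hlist : List.ofFn (fun i => pos (a i)) = List.ofFn pos := by
      refine S.ev_inj _ _ ?_ hposred ?_
      · unfold IsRed
        rw [List.isChain_iff_getElem]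
        intro i hi
        simp only [List.getElem_ofFn]
        exact hpos _ _ (fun hn => by simpa [Fin.ext_iff] using hinj hn)
      · have h := hg
        rw [map_gElt, map_gElt] at h
        simp only [hθ, hψ, hW, ev_nil, one_mul, inv_one, mul_one] at h
        rw [ev, ev, List.map_ofFn, List.map_ofFn]
        exact h
    have hfun := List.ofFn_injective hlist
    ext i
    rw [hθ, hψ, hW, congrFun hfun i]
    simp

/-- Transitivity of the Hurwitz action on factorizations into conjugates of letters. -/
lemma LetterSystem.exists_braidAut (S : LetterSystem inv e) (pos : Fin n → A)
    (hpos : ∀ i j, i ≠ j → pos j ≠ inv (pos i))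
    (χ : G →* Multiplicative (Fin n → ZMod 2))
    (hχ : ∀ i, χ (e (pos i)) = Multiplicative.ofAdd (Pi.single i 1))
    (ψ : FreeGroup (Fin n) →* G) (hψ : ∀ i, ψ (of i) = e (pos i))
    (t : Fin n → G) (ht : ∀ i, ∃ w k, t i = w * e (pos k) * w⁻¹)
    (hg : (List.ofFn t).prod = ψ (gElt n)) :
    ∃ φ ∈ braidAuts n, ∀ i, t i = ψ (φ (of i)) := by
  choose w a hw using ht
  choose L hL using S.ev_surj
  obtain ⟨φ, hφ, h⟩ := S.exists_braidAut_of_words pos hpos χ hχ ψ hψ _ (lift t)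
    (fun i => L (w i)) a (fun i => by simp [hw, hL]) rfl (by rw [map_gElt]; simpa using hg)
  exact ⟨φ, hφ, fun i => by rw [← h]; simp⟩

end Transitivity

section NormalForms

open FreeGroup

variable {n : ℕ}

/-- The formal inverse of a letter of the free group. -/
def flipLetter (p : Fin n × Bool) : Fin n × Bool := (p.1, !p.2)

lemma isRed_flipLetter_iff {L : List (Fin n × Bool)} :
    IsRed flipLetter L ↔ FreeGroup.IsReduced L := by
  unfold IsRed FreeGroup.IsReduced
  refine ⟨fun h => h.imp ?_, fun h => h.imp ?_⟩
  · rintro ⟨i, b⟩ ⟨j, b'⟩ h1 rfl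
    cases b <;> cases b' <;> simp_all [flipLetter]
  · rintro ⟨i, b⟩ ⟨j, b'⟩ h1 h2
    cases b <;> cases b' <;> simp_all [flipLetter]

lemma ev_mk_singleton (L : List (Fin n × Bool)) :
    ev (fun p => FreeGroup.mk [p]) L = FreeGroup.mk L := by
  induction L with
  | nil => rfl
  | cons p L ih => rw [ev_cons, ih, FreeGroup.mul_mk]; rfl

lemma letterSystem_freeGroup :
    LetterSystem (flipLetter (n := n)) fun p => FreeGroup.mk [p] where
  inv_inv := by simp [flipLetter]
  map_inv := by simp [flipLetter, FreeGroup.inv_mk, FreeGroup.invRev]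
  ev_surj g := ⟨g.toWord, by rw [ev_mk_singleton, FreeGroup.mk_toWord]⟩
  ev_inj L M hL hM h := by
    rw [ev_mk_singleton, ev_mk_singleton] at h
    rw [isRed_flipLetter_iff] at hL hM
    rw [← hL.reduce_eq, ← hM.reduce_eq, ← FreeGroup.toWord_mk, h, FreeGroup.toWord_mk]

lemma sgen_mul_self (i : Fin n) : sgen i * sgen i = 1 := by
  have : PresentedGroup.mk (coxRels n) (of i * of i) = 1 :=
    PresentedGroup.one_of_mem ⟨i, rfl⟩
  rwa [MonoidHom.map_mul] at this

lemma sgen_inv (i : Fin n) : (sgen i)⁻¹ = sgen i :=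
  inv_eq_of_mul_eq_one_left (sgen_mul_self i)

/-- The group homomorphism out of `UCox n` determined by a family of involutions. -/
def coxLift {G : Type*} [Group G] (f : Fin n → G) (hf : ∀ i, f i * f i = 1) : UCox n →* G :=
  PresentedGroup.toGroup (f := f) (by rintro _ ⟨i, rfl⟩; simpa using hf i)

@[simp] lemma coxLift_sgen {G : Type*} [Group G] (f : Fin n → G) (hf : ∀ i, f i * f i = 1)
    (i : Fin n) : coxLift f hf (sgen i) = f i :=
  PresentedGroup.toGroup.of _

@[simp] lemma pr_of (i : Fin n) : pr n (of i) = sgen i := by simp [pr]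

lemma pr_mk (L : List (Fin n × Bool)) : pr n (FreeGroup.mk L) = ev sgen (L.map Prod.fst) := by
  induction L with
  | nil => exact MonoidHom.map_one _
  | cons p L ih =>
    rw [List.map_cons, ev_cons, ← ih, show FreeGroup.mk (p :: L) = FreeGroup.mk [p] * FreeGroup.mk L
      from (FreeGroup.mul_mk (L₁ := [p])).symm, MonoidHom.map_mul]
    congr 1
    obtain ⟨i, b⟩ := p
    cases b <;> simp [pr, sgen_inv]

lemma pr_surjective : Function.Surjective (pr n) := by
  intro w
  obtain ⟨x, rfl⟩ := PresentedGroup.mk_surjective _ w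
  refine ⟨x, ?_⟩
  have : pr n = PresentedGroup.mk (coxRels n) := by
    ext i
    simp [sgen, PresentedGroup.of]
  rw [this]

/-- Left multiplication by a generator on words without repeated adjacent letters. -/
def pushLetter (i : Fin n) (L : {L : List (Fin n) // L.IsChain (· ≠ ·)}) :
    {L : List (Fin n) // L.IsChain (· ≠ ·)} :=
  if h : L.1.head? = some i then ⟨L.1.tail, L.2.tail⟩
  else ⟨i :: L.1, by
    rw [List.isChain_cons]
    exact ⟨fun y hy hn => h (by rw [hn]; exact hy), L.2⟩⟩

lemma pushLetter_pushLetter (i : Fin n) (L : {L : List (Fin n) // L.IsChain (· ≠ ·)}) :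
    pushLetter i (pushLetter i L) = L := by
  obtain ⟨L, hL⟩ := L
  cases L with
  | nil => simp [pushLetter]
  | cons a L =>
    by_cases h : a = i
    · subst h
      cases L with
      | nil => simp [pushLetter]
      | cons b L =>
        have hab : b ≠ a := (List.isChain_cons_cons.1 hL).1.symm
        simp [pushLetter, hab]
    · simp [pushLetter, h]

/-- The action of `UCox n` on words without repeated adjacent letters. -/
def coxWordAction (n : ℕ) : UCox n →* Equiv.Perm {L : List (Fin n) // L.IsChain (· ≠ ·)} :=
  coxLift (fun i => Function.Involutive.toPerm _ (pushLetter_pushLetter i)) fun i => by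
    ext1 L
    exact pushLetter_pushLetter i L

lemma coxWordAction_ev (L : List (Fin n)) (hL : L.IsChain (· ≠ ·)) :
    coxWordAction n (ev sgen L) ⟨[], by simp⟩ = ⟨L, hL⟩ := by
  induction L with
  | nil => simp
  | cons a L ih =>
    rw [ev_cons, MonoidHom.map_mul, Equiv.Perm.mul_apply, ih hL.tail, coxWordAction, coxLift_sgen]
    have : L.head? ≠ some a := fun h => (List.isChain_cons.1 hL).1 a h rfl
    change pushLetter a ⟨L, hL.tail⟩ = _
    simp [pushLetter, this]

lemma letterSystem_cox : LetterSystem (id : Fin n → Fin n) sgen where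
  inv_inv := by simp
  map_inv i := by simp [sgen_inv]
  ev_surj w := by
    obtain ⟨x, rfl⟩ := pr_surjective w
    exact ⟨x.toWord.map Prod.fst, by rw [← pr_mk, FreeGroup.mk_toWord]⟩
  ev_inj L M hL hM h := by
    have hL' : L.IsChain (· ≠ ·) := hL.imp fun _ _ h => h.symm
    have hM' : M.IsChain (· ≠ ·) := hM.imp fun _ _ h => h.symm
    have := coxWordAction_ev L hL'
    rw [h, coxWordAction_ev M hM'] at this
    exact (congrArg Subtype.val this).symm

end NormalForms

section CyclicOrder

open FreeGroup

variable {n : ℕ}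

/-- The position of a letter in the cyclic order `f_1 < f_1⁻¹ < f_2 < f_2⁻¹ < ⋯` on directions. -/
def letterCode (p : Fin n × Bool) : ℕ := 2 * (p.1 : ℕ) + bif p.2 then 1 else 2

lemma letterCode_injective : Function.Injective (letterCode (n := n)) := by
  rintro ⟨i, b⟩ ⟨j, b'⟩ h
  cases b <;> cases b' <;> simp [letterCode] at h <;> simp [Fin.ext_iff] <;> omega

lemma letterCode_pos (p : Fin n × Bool) : 0 < letterCode p := by
  obtain ⟨i, b⟩ := p
  cases b <;> simp [letterCode]

/-- The code of the first letter of the reduced word of `x`, and `0` if `x = 1`. -/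
def headCode (x : FreeGroup (Fin n)) : ℕ := x.toWord.head?.elim 0 letterCode

@[simp] lemma headCode_one : headCode (1 : FreeGroup (Fin n)) = 0 := by simp [headCode]

lemma headCode_eq_zero {x : FreeGroup (Fin n)} (h : headCode x = 0) : x = 1 := by
  rw [← FreeGroup.toWord_eq_nil_iff]
  unfold headCode at h
  cases hx : x.toWord with
  | nil => rfl
  | cons p L =>
    rw [hx] at h
    exact absurd h (letterCode_pos p).ne'

lemma toWord_mk_of_isReduced {L : List (Fin n × Bool)} (h : FreeGroup.IsReduced L) :
    (FreeGroup.mk L).toWord = L := by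
  rw [FreeGroup.toWord_mk, h.reduce_eq]

lemma head?_invRev (L : List (Fin n × Bool)) :
    (FreeGroup.invRev L).head? = L.getLast?.map flipLetter := by
  simp only [FreeGroup.invRev, List.head?_reverse, List.getLast?_map]
  rfl

lemma flipLetter_flipLetter (p : Fin n × Bool) : flipLetter (flipLetter p) = p := by
  simp [flipLetter]

lemma toWord_mul_of_headCode_ne {y a : FreeGroup (Fin n)} (h : headCode a ≠ headCode y⁻¹) :
    (y * a).toWord = y.toWord ++ a.toWord := by
  have hred : FreeGroup.IsReduced (y.toWord ++ a.toWord) := by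
    rw [← isRed_flipLetter_iff]
    refine List.IsChain.append (isRed_flipLetter_iff.2 FreeGroup.isReduced_toWord)
      (isRed_flipLetter_iff.2 FreeGroup.isReduced_toWord) ?_
    rintro p hp q hq rfl
    apply h
    unfold headCode
    rw [FreeGroup.toWord_inv, head?_invRev, hp, hq]
    rfl
  rw [← toWord_mk_of_isReduced hred, ← FreeGroup.mul_mk, FreeGroup.mk_toWord, FreeGroup.mk_toWord]

lemma headCode_mul_of_ne {y a : FreeGroup (Fin n)} (hy : y ≠ 1)
    (h : headCode a ≠ headCode y⁻¹) : headCode (y * a) = headCode y := by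
  unfold headCode
  rw [toWord_mul_of_headCode_ne h, List.head?_append]
  cases hw : y.toWord with
  | nil => exact absurd (FreeGroup.toWord_eq_nil_iff.1 hw) hy
  | cons p L => simp

lemma headCode_mk_singleton (p : Fin n × Bool) : headCode (FreeGroup.mk [p]) = letterCode p := by
  simp [headCode]

lemma inv_mk_singleton (p : Fin n × Bool) :
    (FreeGroup.mk [p])⁻¹ = FreeGroup.mk [flipLetter p] := by
  simp [FreeGroup.inv_mk, FreeGroup.invRev, flipLetter]

lemma mk_singleton_ne_one (p : Fin n × Bool) : FreeGroup.mk [p] ≠ 1 := fun h =>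
  (letterCode_pos p).ne' (by rw [← headCode_mk_singleton, h, headCode_one])

lemma headCode_letter_mul (p : Fin n × Bool) {y : FreeGroup (Fin n)}
    (h : headCode y ≠ letterCode (flipLetter p)) :
    headCode (FreeGroup.mk [p] * y) = letterCode p := by
  rw [headCode_mul_of_ne (mk_singleton_ne_one p), headCode_mk_singleton]
  rwa [inv_mk_singleton, headCode_mk_singleton]

lemma headCode_mk_ne {p : Fin n × Bool} {L : List (Fin n × Bool)}
    (h : FreeGroup.IsReduced (p :: L)) :
    headCode (FreeGroup.mk L) ≠ letterCode (flipLetter p) := by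
  have hL : FreeGroup.IsReduced L := List.IsChain.tail h
  rw [headCode, toWord_mk_of_isReduced hL]
  intro hq
  rw [← isRed_flipLetter_iff] at h
  cases L with
  | nil => exact absurd hq (letterCode_pos _).ne
  | cons q L => exact (List.isChain_cons_cons.1 h).1 (letterCode_injective hq)

lemma headCode_mk_inv_ne {p : Fin n × Bool} {L M : List (Fin n × Bool)}
    (h : FreeGroup.IsReduced (L ++ p :: M)) : headCode (FreeGroup.mk L)⁻¹ ≠ letterCode p := by
  rw [headCode, FreeGroup.toWord_inv, toWord_mk_of_isReduced (List.IsChain.left_of_append h),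
    head?_invRev]
  intro hq
  rw [← isRed_flipLetter_iff] at h
  cases hl : L.getLast? with
  | none =>
    rw [hl] at hq
    exact absurd hq (letterCode_pos _).ne
  | some q =>
    rw [hl] at hq
    exact (List.isChain_append.1 h).2.2 q hl p rfl (letterCode_injective hq).symm

/-- Induction on the reduced word of an element of the free group. -/
lemma reduced_induction {P : FreeGroup (Fin n) → Prop} (one : P 1)
    (mul : ∀ p y, headCode y ≠ letterCode (flipLetter p) → P y → P (FreeGroup.mk [p] * y))
    (x : FreeGroup (Fin n)) : P x := by
  rw [← FreeGroup.mk_toWord (x := x)]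
  have hx : FreeGroup.IsReduced x.toWord := FreeGroup.isReduced_toWord
  generalize x.toWord = L at hx
  induction L with
  | nil => exact one
  | cons p L ih =>
    have : FreeGroup.mk (p :: L) = FreeGroup.mk [p] * FreeGroup.mk L :=
      (FreeGroup.mul_mk (L₁ := [p])).symm
    rw [this]
    exact mul p _ (headCode_mk_ne hx) (ih (List.IsChain.tail hx))

lemma headCode_letter_inv_mul_ne (p : Fin n × Bool) {x : FreeGroup (Fin n)}
    (h : headCode x = letterCode p) :
    headCode ((FreeGroup.mk [p])⁻¹ * x) ≠ letterCode (flipLetter p) := by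
  induction x using reduced_induction with
  | one => exact absurd h (by simpa using (letterCode_pos p).ne)
  | mul q y hy _ =>
    rw [headCode_letter_mul q hy] at h
    obtain rfl := letterCode_injective h
    rwa [inv_mul_cancel_left]

lemma headCode_of_mul (i : Fin n) {y : FreeGroup (Fin n)} (h : headCode y ≠ 2 * (i : ℕ) + 2) :
    headCode (of i * y) = 2 * (i : ℕ) + 1 :=
  headCode_letter_mul (i, true) h

lemma headCode_of_inv_mul (i : Fin n) {y : FreeGroup (Fin n)}
    (h : headCode y ≠ 2 * (i : ℕ) + 1) : headCode ((of i)⁻¹ * y) = 2 * (i : ℕ) + 2 :=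
  headCode_letter_mul (i, false) h

/-- Induction on the reduced word, in terms of the generators and their inverses. -/
lemma reduced_induction_of {P : FreeGroup (Fin n) → Prop} (one : P 1)
    (mul_of : ∀ (i : Fin n) y, headCode y ≠ 2 * (i : ℕ) + 2 → P y → P (of i * y))
    (mul_of_inv : ∀ (i : Fin n) y, headCode y ≠ 2 * (i : ℕ) + 1 → P y → P ((of i)⁻¹ * y))
    (x : FreeGroup (Fin n)) : P x := by
  refine reduced_induction one ?_ x
  rintro ⟨i, _ | _⟩ y h hy
  · exact mul_of_inv i y h hy
  · exact mul_of i y h hy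

/-- Strict cyclic order of three natural numbers. -/
def Cyc (a b c : ℕ) : Prop := (a < b ∧ b < c) ∨ (b < c ∧ c < a) ∨ (c < a ∧ a < b)

/-- The planar cyclic order on the free group, seen as the vertex set of its Cayley tree: the
directions of the three points from some vertex are cyclically ordered. -/
def CycOrd (x y z : FreeGroup (Fin n)) : Prop :=
  ∃ v : FreeGroup (Fin n), Cyc (headCode (v⁻¹ * x)) (headCode (v⁻¹ * y)) (headCode (v⁻¹ * z))

lemma CycOrd.mul_left {x y z : FreeGroup (Fin n)} (h : CycOrd x y z) (w : FreeGroup (Fin n)) :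
    CycOrd (w * x) (w * y) (w * z) := by
  obtain ⟨v, hv⟩ := h
  exact ⟨w * v, by simpa [mul_assoc] using hv⟩

lemma headCode_eq_of_ne {v v' x : FreeGroup (Fin n)} (hv : v ≠ v')
    (h : headCode (v⁻¹ * x) ≠ headCode (v⁻¹ * v')) :
    headCode (v'⁻¹ * x) = headCode (v'⁻¹ * v) := by
  have := headCode_mul_of_ne (y := v'⁻¹ * v) (a := v⁻¹ * x)
    (fun h => hv (inv_mul_eq_one.1 h).symm) (by simpa using h)
  simpa [mul_assoc] using this

lemma CycOrd.asymm {x y z : FreeGroup (Fin n)} (h : CycOrd x y z) : ¬ CycOrd x z y := by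
  rintro ⟨v', h'⟩
  obtain ⟨v, h⟩ := h
  unfold Cyc at h h'
  by_cases hv : v = v'
  · subst hv
    omega
  · have hx := headCode_eq_of_ne (x := x) hv
    have hy := headCode_eq_of_ne (x := y) hv
    have hz := headCode_eq_of_ne (x := z) hv
    omega

lemma CycOrd.ne {x y z : FreeGroup (Fin n)} (h : CycOrd x y z) : x ≠ y ∧ y ≠ z ∧ x ≠ z := by
  obtain ⟨v, h⟩ := h
  unfold Cyc at h
  refine ⟨?_, ?_, ?_⟩ <;> rintro rfl <;> omega

lemma headCode_mul_of {z : FreeGroup (Fin n)} {i : Fin n} (hz : z ≠ 1) (hzi : z * of i ≠ 1) :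
    headCode (z * of i) = headCode z := by
  have hi : headCode (of i) = 2 * (i : ℕ) + 1 := headCode_mk_singleton (i, true)
  have hi' : headCode (of i)⁻¹ = 2 * (i : ℕ) + 2 := headCode_mk_singleton (i, false)
  by_cases h : headCode (of i) = headCode z⁻¹
  · have := headCode_mul_of_ne (y := z * of i) (a := (of i)⁻¹) hzi (by
      rw [hi', mul_inv_rev]
      exact (headCode_letter_inv_mul_ne (i, true) (h.symm.trans hi)).symm)
    simpa using this.symm
  · exact headCode_mul_of_ne hz h

/-- A center separating the endpoints of the edge from `1` to `f_i` is one of these endpoints. -/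
lemma eq_one_or_eq_of_headCode_ne {y : FreeGroup (Fin n)} {i : Fin n}
    (h : headCode (y⁻¹ * 1) ≠ headCode (y⁻¹ * of i)) : y = 1 ∨ y = of i := by
  by_contra! hy
  apply h
  rw [mul_one, headCode_mul_of (by simpa using hy.1) (fun h => hy.2 (inv_mul_eq_one.1 h))]

lemma headCode_inv_mul_mul_of {y v : FreeGroup (Fin n)} {i : Fin n} (h1 : v ≠ y)
    (h2 : v * of i ≠ y) : headCode (y⁻¹ * (v * of i)) = headCode (y⁻¹ * v) := by
  rw [← mul_assoc]
  apply headCode_mul_of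
  · exact fun h => h1 (inv_mul_eq_one.1 h).symm
  · rw [mul_assoc]
    exact fun h => h2 (inv_mul_eq_one.1 h).symm

/-- The edge from `1` to `f_i` does not cross its translates. -/
lemma CycOrd.not_linked {v : FreeGroup (Fin n)} {i : Fin n} (h : CycOrd 1 v (of i)) :
    ¬ CycOrd 1 (of i) (v * of i) := by
  intro h'
  refine h'.asymm ?_
  have hne := h.ne
  have hne' := h'.ne
  obtain ⟨y, hy⟩ := h
  refine ⟨y, ?_⟩
  rw [headCode_inv_mul_mul_of]
  · exact hy
  all_goals
    rcases eq_one_or_eq_of_headCode_ne (y := y) (i := i) (by unfold Cyc at hy; omega) with rfl | rfl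
  · exact hne.1.symm
  · exact hne.2.1
  · exact hne'.2.2.symm
  · exact hne'.2.1.symm

/-- The edge from `1` to `f_i` does not cross its translates. -/
lemma CycOrd.not_linked' {v : FreeGroup (Fin n)} {i : Fin n} (h : CycOrd 1 (of i) v) :
    ¬ CycOrd 1 (v * of i) (of i) := by
  intro h'
  refine h'.asymm ?_
  have hne := h.ne
  have hne' := h'.ne
  obtain ⟨y, hy⟩ := h
  refine ⟨y, ?_⟩
  rw [headCode_inv_mul_mul_of]
  · exact hy
  all_goals
    rcases eq_one_or_eq_of_headCode_ne (y := y) (i := i) (by unfold Cyc at hy; omega) with rfl | rfl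
  · exact hne.2.2.symm
  · exact hne.2.1.symm
  · exact hne'.1.symm
  · exact hne'.2.1

end CyclicOrder

section BraidInvariance

open FreeGroup

variable {n : ℕ}

/-- The relation between the codes `κ`, `α`, `β` of the first letters of `x`, `φ x`, `f_i⁻¹ φ x`,
where `φ` is the Artin automorphism `f_i ↦ f_i f_{i+1} f_i⁻¹`, `f_{i+1} ↦ f_i` and `m = 2 * i`. -/
def Sector (m κ α β : ℕ) : Prop :=
  (κ = m + 1 ∧ α = m + 1 ∧ β = m + 3 ∨
    κ = m + 2 ∧ α = m + 1 ∧ β = m + 4 ∨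
    κ = m + 3 ∧ α = m + 1 ∧ (β ≤ m + 1 ∨ m + 4 < β) ∨
    κ = m + 4 ∧ m + 1 < α ∧ α ≤ m + 4 ∨
    (κ ≤ m ∨ m + 4 < κ) ∧ α = κ) ∧ (α ≠ m + 1 → β = m + 2)

lemma Sector.lt {m a a₁ a₂ b b₁ b₂ : ℕ} (ha : Sector m a a₁ a₂) (hb : Sector m b b₁ b₂)
    (hab : a < b) (hS : ¬ (m < a ∧ b ≤ m + 3)) : a₁ < b₁ := by
  rcases ha.1 with ha | ha | ha | ha | ha <;> rcases hb.1 with hb | hb | hb | hb | hb <;> omega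

lemma Sector.snd {m a a₁ a₂ : ℕ} (h : Sector m a a₁ a₂) :
    a = m + 1 ∧ a₂ = m + 3 ∨ a = m + 2 ∧ a₂ = m + 4 ∨
      a = m + 3 ∧ (a₂ ≤ m + 1 ∨ m + 4 < a₂) ∨ (a ≤ m ∨ m + 3 < a) ∧ a₂ = m + 2 := by
  obtain ⟨h, h'⟩ := h
  rcases h with h | h | h | h | h <;> omega

lemma Sector.cyc {m a a₁ a₂ b b₁ b₂ c c₁ c₂ : ℕ} (ha : Sector m a a₁ a₂) (hb : Sector m b b₁ b₂)
    (hc : Sector m c c₁ c₂) (h : Cyc a b c) (haS : m < a ∧ a ≤ m + 3) (hbS : m < b ∧ b ≤ m + 3) :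
    Cyc a₂ b₂ c₂ := by
  replace ha := ha.snd
  replace hb := hb.snd
  replace hc := hc.snd
  unfold Cyc at *
  rcases ha with ha | ha | ha | ha <;> rcases hb with hb | hb | hb | hb <;>
    omega

lemma Cyc.rotate {a b c : ℕ} (h : Cyc a b c) : Cyc b c a := by
  unfold Cyc at *
  omega

lemma Sector.cyc_or_cyc {m a a₁ a₂ b b₁ b₂ c c₁ c₂ : ℕ} (ha : Sector m a a₁ a₂)
    (hb : Sector m b b₁ b₂) (hc : Sector m c c₁ c₂) (h : Cyc a b c) :
    Cyc a₁ b₁ c₁ ∨ Cyc a₂ b₂ c₂ := by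
  by_cases hab : (m < a ∧ a ≤ m + 3) ∧ (m < b ∧ b ≤ m + 3)
  · exact .inr (ha.cyc hb hc h hab.1 hab.2)
  by_cases hbc : (m < b ∧ b ≤ m + 3) ∧ (m < c ∧ c ≤ m + 3)
  · exact .inr (hb.cyc hc ha h.rotate hbc.1 hbc.2).rotate.rotate
  by_cases hca : (m < c ∧ c ≤ m + 3) ∧ (m < a ∧ a ≤ m + 3)
  · exact .inr (hc.cyc ha hb h.rotate.rotate hca.1 hca.2).rotate
  left
  rcases h with h | h | h
  · exact .inl ⟨ha.lt hb h.1 (by omega), hb.lt hc h.2 (by omega)⟩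
  · exact .inr (.inl ⟨hb.lt hc h.1 (by omega), hc.lt ha h.2 (by omega)⟩)
  · exact .inr (.inr ⟨hc.lt ha h.1 (by omega), ha.lt hb h.2 (by omega)⟩)

lemma sector_braidHom {i j : Fin n} (hij : (j : ℕ) = i + 1) (x : FreeGroup (Fin n)) :
    Sector (2 * i) (headCode x) (headCode (braidHom i j x))
      (headCode ((of i)⁻¹ * braidHom i j x)) := by
  refine ⟨?_, fun h => headCode_of_inv_mul i h⟩
  have hji : j ≠ i := by rintro rfl; omega
  induction x using reduced_induction_of with
  | one => simp
  | mul_of k y hy ih =>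
    have hβ := fun h => headCode_of_inv_mul i (y := braidHom i j y) h
    have hx := headCode_of_mul k hy
    rw [MonoidHom.map_mul, braidHom_of]
    by_cases hki : k = i
    · subst hki
      have h1 := headCode_of_mul j (y := (of k)⁻¹ * braidHom k j y) (by omega)
      have h2 := headCode_of_mul k (y := of j * ((of k)⁻¹ * braidHom k j y)) (by omega)
      simp only [if_true, mul_assoc, inv_mul_cancel_left]
      exact .inl ⟨hx, h2, by omega⟩
    by_cases hkj : k = j
    · subst hkj
      have h1 := headCode_of_mul i (y := braidHom i k y) (by omega)
      simp only [hki, if_true, if_false, inv_mul_cancel_left]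
      exact .inr (.inr (.inl ⟨by omega, h1, by omega⟩))
    have hki' : (k : ℕ) ≠ i := fun h => hki (Fin.ext h)
    have hkj' : (k : ℕ) ≠ j := fun h => hkj (Fin.ext h)
    have h1 := headCode_of_mul k (y := braidHom i j y) (by omega)
    simp only [hki, hkj, if_false]
    exact .inr (.inr (.inr (.inr ⟨by omega, h1.trans hx.symm⟩)))
  | mul_of_inv k y hy ih =>
    have hβ := fun h => headCode_of_inv_mul i (y := braidHom i j y) h
    have hx := headCode_of_inv_mul k hy
    rw [MonoidHom.map_mul, MonoidHom.map_inv, braidHom_of]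
    by_cases hki : k = i
    · subst hki
      have h1 := headCode_of_inv_mul j (y := (of k)⁻¹ * braidHom k j y) (by omega)
      have h2 := headCode_of_mul k (y := (of j)⁻¹ * ((of k)⁻¹ * braidHom k j y)) (by omega)
      simp only [if_true, mul_assoc, mul_inv_rev, inv_inv, inv_mul_cancel_left]
      exact .inr (.inl ⟨hx, h2, by omega⟩)
    by_cases hkj : k = j
    · subst hkj
      simp only [hki, if_true, if_false]
      exact .inr (.inr (.inr (.inl ⟨by omega, by omega, by omega⟩)))
    have hki' : (k : ℕ) ≠ i := fun h => hki (Fin.ext h)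
    have hkj' : (k : ℕ) ≠ j := fun h => hkj (Fin.ext h)
    have h1 := headCode_of_inv_mul k (y := braidHom i j y) (by omega)
    simp only [hki, hkj, if_false]
    exact .inr (.inr (.inr (.inr ⟨by omega, h1.trans hx.symm⟩)))

lemma CycOrd.map_braidHom {i j : Fin n} (hij : (j : ℕ) = i + 1) {x y z : FreeGroup (Fin n)}
    (h : CycOrd x y z) : CycOrd (braidHom i j x) (braidHom i j y) (braidHom i j z) := by
  obtain ⟨v, hv⟩ := h
  rcases (sector_braidHom hij _).cyc_or_cyc (sector_braidHom hij _) (sector_braidHom hij _) hv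
    with h | h
  · exact ⟨braidHom i j v, by simpa using h⟩
  · exact ⟨braidHom i j v * of i, by simpa [mul_assoc] using h⟩

/-- Two distinct nontrivial elements and `1` leave some vertex in three distinct directions. -/
lemma exists_headCode_ne {y z : FreeGroup (Fin n)} (hy : y ≠ 1) (hz : z ≠ 1) (hyz : y ≠ z) :
    ∃ v : FreeGroup (Fin n), headCode v⁻¹ ≠ headCode (v⁻¹ * y) ∧
      headCode v⁻¹ ≠ headCode (v⁻¹ * z) ∧ headCode (v⁻¹ * y) ≠ headCode (v⁻¹ * z) := by
  induction y using reduced_induction generalizing z with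
  | one => exact absurd rfl hy
  | mul p y hpy ih =>
    by_cases hhead : headCode z = letterCode p
    · obtain ⟨z, rfl⟩ : ∃ z', z = FreeGroup.mk [p] * z' := 
        ⟨(FreeGroup.mk [p])⁻¹ * z, (mul_inv_cancel_left _ _).symm⟩
      have hpz := headCode_letter_inv_mul_ne p hhead
      rw [inv_mul_cancel_left] at hpz
      have hyz' : y ≠ z := fun h => hyz (by rw [h])
      by_cases h1 : y = 1 ∨ z = 1
      · refine ⟨FreeGroup.mk [p], ?_⟩
        rw [inv_mul_cancel_left, inv_mul_cancel_left, inv_mk_singleton, headCode_mk_singleton]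
        refine ⟨hpy.symm, hpz.symm, ?_⟩
        rcases h1 with rfl | rfl
        · rw [headCode_one]
          exact fun h => hyz' (headCode_eq_zero h.symm).symm
        · rw [headCode_one]
          exact fun h => hyz' (headCode_eq_zero h)
      · push Not at h1
        obtain ⟨v, h2, h3, h4⟩ := ih h1.1 h1.2 hyz'
        refine ⟨FreeGroup.mk [p] * v, ?_⟩
        suffices h : headCode (v⁻¹ * (FreeGroup.mk [p])⁻¹) ≠ headCode (v⁻¹ * y) ∧
            headCode (v⁻¹ * (FreeGroup.mk [p])⁻¹) ≠ headCode (v⁻¹ * z) by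
          simpa only [mul_inv_rev, mul_assoc, inv_mul_cancel_left] using ⟨h.1, h.2, h4⟩
        by_cases hv : v = 1
        · subst hv
          simp only [inv_one, one_mul]
          rw [inv_mk_singleton, headCode_mk_singleton]
          exact ⟨hpy.symm, hpz.symm⟩
        · by_cases hvp : headCode v = letterCode (flipLetter p)
          · have key := fun x h => headCode_eq_of_ne (v := 1) (v' := v) (x := x) (Ne.symm hv) h
            simp only [inv_one, one_mul, mul_one, hvp] at key
            exact absurd (key y hpy).symm h2
          · have := headCode_mul_of_ne (y := v⁻¹) (a := (FreeGroup.mk [p])⁻¹)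
              (by simpa using hv) (by
                rw [inv_inv, inv_mk_singleton, headCode_mk_singleton]
                exact Ne.symm hvp)
            rw [this]
            exact ⟨h2, h3⟩
    · refine ⟨1, ?_⟩
      simp only [inv_one, one_mul, headCode_one, headCode_letter_mul p hpy]
      exact ⟨(letterCode_pos p).ne, fun h => hz (headCode_eq_zero h.symm), Ne.symm hhead⟩

lemma CycOrd.total {x y z : FreeGroup (Fin n)} (hxy : x ≠ y) (hyz : y ≠ z) (hxz : x ≠ z) :
    CycOrd x y z ∨ CycOrd x z y := by
  obtain ⟨v, h1, h2, h3⟩ := exists_headCode_ne (y := x⁻¹ * y) (z := x⁻¹ * z)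
    (fun h => hxy (inv_mul_eq_one.1 h)) (fun h => hxz (inv_mul_eq_one.1 h)) (by simpa using hyz)
  have key : Cyc (headCode v⁻¹) (headCode (v⁻¹ * (x⁻¹ * y))) (headCode (v⁻¹ * (x⁻¹ * z))) ∨
      Cyc (headCode v⁻¹) (headCode (v⁻¹ * (x⁻¹ * z))) (headCode (v⁻¹ * (x⁻¹ * y))) := by
    unfold Cyc
    omega
  rcases key with h | h
  · exact .inl ⟨x * v, by simpa [mul_assoc] using h⟩
  · exact .inr ⟨x * v, by simpa [mul_assoc] using h⟩

/-- The braid automorphisms preserve the planar cyclic order. -/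
lemma CycOrd.map_braidAut {φ : MulAut (FreeGroup (Fin n))} (hφ : φ ∈ braidAuts n)
    {x y z : FreeGroup (Fin n)} (h : CycOrd x y z) : CycOrd (φ x) (φ y) (φ z) := by
  revert x y z
  refine braidAuts_induction (p := fun φ => ∀ {x y z : FreeGroup (Fin n)}, CycOrd x y z →
    CycOrd (φ x) (φ y) (φ z)) id ?_ ?_ ?_ hφ
  · intro φ ψ h1 h2 x y z h
    exact h1 (h2 h)
  · intro i j _ hij x y z h
    exact h.map_braidHom hij
  · intro i j hne hij x y z h
    have hxyz := h.ne
    have hinj := ((braidAut i j hne)⁻¹).injective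
    refine (CycOrd.total (hinj.ne hxyz.1) (hinj.ne hxyz.2.1) (hinj.ne hxyz.2.2)).resolve_right ?_
    intro h'
    have := h'.map_braidHom hij
    simp only [← braidAut_apply i j hne, MulAut.apply_inv_self] at this
    exact h.asymm this

end BraidInvariance

section RepeatedLetters

open FreeGroup

variable {n : ℕ}

lemma exists_eq_pow_mul (p : Fin n × Bool) {x : FreeGroup (Fin n)}
    (hx : headCode x ≠ letterCode (flipLetter p)) :
    ∃ (m : ℕ) (q : FreeGroup (Fin n)), x = FreeGroup.mk [p] ^ m * q ∧
      headCode q ≠ letterCode p ∧ headCode q ≠ letterCode (flipLetter p) := by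
  induction x using reduced_induction with
  | one =>
    refine ⟨0, 1, ?_, ?_, ?_⟩
    · simp
    · simpa using (letterCode_pos _).ne
    · simpa using (letterCode_pos _).ne
  | mul r y hy ih =>
    by_cases hr : r = p
    · subst hr
      obtain ⟨m, q, rfl, hq⟩ := ih hy
      exact ⟨m + 1, q, by rw [pow_succ', mul_assoc], hq⟩
    · refine ⟨0, FreeGroup.mk [r] * y, by rw [pow_zero, one_mul], ?_, hx⟩
      rw [headCode_letter_mul r hy]
      exact letterCode_injective.ne hr

lemma headCode_pow_mul (p : Fin n × Bool) (m : ℕ) {q : FreeGroup (Fin n)}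
    (hq : headCode q ≠ letterCode (flipLetter p)) :
    headCode (FreeGroup.mk [p] ^ (m + 1) * q) = letterCode p := by
  induction m with
  | zero => simpa using headCode_letter_mul p hq
  | succ m ih =>
    rw [pow_succ', mul_assoc, headCode_letter_mul]
    rw [ih]
    refine letterCode_injective.ne ?_
    simp [flipLetter, Prod.ext_iff]

/-- A reduced word with a repeated letter spells an element whose edge crosses one of its
translates. -/
lemma exists_linked (p : Fin n × Bool) (m : ℕ) {r q : FreeGroup (Fin n)}
    (hr : headCode r ≠ letterCode p) (hr' : headCode r ≠ letterCode (flipLetter p))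
    (hq : headCode q ≠ letterCode p) (hq' : headCode q ≠ letterCode (flipLetter p))
    {t : FreeGroup (Fin n)} (ht : t = r⁻¹ * (FreeGroup.mk [p] ^ (m + 2) * q)) :
    ∃ u, CycOrd 1 u t ∧ CycOrd 1 t (u * t) ∨ CycOrd 1 t u ∧ CycOrd 1 (u * t) t := by
  have a1 : headCode ((FreeGroup.mk [p])⁻¹ * r) = letterCode (flipLetter p) := by
    rw [inv_mk_singleton]
    exact headCode_letter_mul _ (by rwa [flipLetter_flipLetter])
  have a2 : headCode ((FreeGroup.mk [p])⁻¹ * (FreeGroup.mk [p] ^ (m + 2) * q)) =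
      letterCode p := by
    rw [pow_succ', mul_assoc, inv_mul_cancel_left]
    exact headCode_pow_mul p m hq'
  have a3 : headCode ((FreeGroup.mk [p])⁻¹ * (FreeGroup.mk [p] * r)) = headCode r := by
    rw [inv_mul_cancel_left]
  have b1 : headCode ((FreeGroup.mk [p] ^ (m + 2))⁻¹ * r) = letterCode (flipLetter p) := by
    rw [← inv_pow, inv_mk_singleton]
    exact headCode_pow_mul _ _ (by rwa [flipLetter_flipLetter])
  have b2 : headCode ((FreeGroup.mk [p] ^ (m + 2))⁻¹ * (FreeGroup.mk [p] ^ (m + 2) * q)) =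
      headCode q := by
    rw [inv_mul_cancel_left]
  have b3 : headCode ((FreeGroup.mk [p] ^ (m + 2))⁻¹ *
      (FreeGroup.mk [p] * (FreeGroup.mk [p] ^ (m + 2) * q))) = letterCode p := by
    rw [← mul_assoc (FreeGroup.mk [p]), ← pow_succ', pow_succ _ (m + 2), mul_assoc,
      inv_mul_cancel_left]
    exact headCode_letter_mul p hq'
  subst ht
  refine ⟨r⁻¹ * FreeGroup.mk [p] * r, ?_⟩
  have e : r⁻¹ * FreeGroup.mk [p] * r * (r⁻¹ * (FreeGroup.mk [p] ^ (m + 2) * q)) =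
      r⁻¹ * (FreeGroup.mk [p] * (FreeGroup.mk [p] ^ (m + 2) * q)) := by
    simp only [mul_assoc, mul_inv_cancel_left]
  rw [e, ← inv_mul_cancel r, mul_assoc]
  generalize hx : FreeGroup.mk [p] * r = x at *
  generalize hy : FreeGroup.mk [p] ^ (m + 2) * q = y at *
  generalize hz : FreeGroup.mk [p] * y = z at *
  obtain ⟨k, _ | _⟩ := p
  · right
    simp only [letterCode, flipLetter, Bool.not_false, cond_true, cond_false] at *
    exact ⟨CycOrd.mul_left ⟨_, by rw [a1, a2, a3]; unfold Cyc; omega⟩ _,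
      CycOrd.mul_left ⟨_, by rw [b1, b2, b3]; unfold Cyc; omega⟩ _⟩
  · left
    simp only [letterCode, flipLetter, Bool.not_true, cond_true, cond_false] at *
    exact ⟨CycOrd.mul_left ⟨_, by rw [a1, a2, a3]; unfold Cyc; omega⟩ _,
      CycOrd.mul_left ⟨_, by rw [b1, b2, b3]; unfold Cyc; omega⟩ _⟩

/-- The reduced word of the image of a generator under a braid automorphism has no two adjacent
letters with the same underlying generator. -/
lemma isChain_toWord_braidAut {φ : MulAut (FreeGroup (Fin n))} (hφ : φ ∈ braidAuts n) (i : Fin n) :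
    ((φ (of i)).toWord.map Prod.fst).IsChain (· ≠ ·) := by
  rw [List.isChain_map]
  by_contra hbad
  rw [List.isChain_iff_forall_rel_of_append_cons_cons] at hbad
  push Not at hbad
  obtain ⟨a, b, P, Q, hw, hab⟩ := hbad
  have hred : FreeGroup.IsReduced (P ++ a :: b :: Q) := hw ▸ FreeGroup.isReduced_toWord
  have hred' : FreeGroup.IsReduced (a :: b :: Q) := List.IsChain.right_of_append hred
  obtain rfl : a = b := Prod.ext hab ((List.isChain_cons_cons.1 hred').1 hab)
  obtain ⟨m, q, hm, hq, hq'⟩ := exists_eq_pow_mul a (headCode_mk_ne (List.IsChain.tail hred'))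
  obtain ⟨l, r, hl, hr, hr'⟩ := exists_eq_pow_mul (flipLetter a) (x := (FreeGroup.mk P)⁻¹)
    (by rw [flipLetter_flipLetter]; exact headCode_mk_inv_ne hred)
  rw [flipLetter_flipLetter] at hr'
  have ht : φ (of i) = r⁻¹ * (FreeGroup.mk [a] ^ (l + m + 2) * q) := by
    have hP : FreeGroup.mk P = r⁻¹ * FreeGroup.mk [a] ^ l := by
      rw [← inv_inv (FreeGroup.mk P), hl, ← inv_mk_singleton, mul_inv_rev, ← inv_pow, inv_inv]
    have hQ : FreeGroup.mk (a :: a :: Q) = FreeGroup.mk [a] ^ 2 * FreeGroup.mk Q := by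
      rw [pow_two, FreeGroup.mul_mk, FreeGroup.mul_mk]
      rfl
    rw [← FreeGroup.mk_toWord (x := φ (of i)), hw, ← FreeGroup.mul_mk, hP, hQ, hm]
    rw [show l + m + 2 = l + (2 + m) by omega, pow_add, pow_add]
    simp only [mul_assoc]
  obtain ⟨u, hu⟩ := exists_linked a (l + m) hr' hr hq hq' ht
  have hinv := fun {x y z} h => CycOrd.map_braidAut (x := x) (y := y) (z := z) (inv_mem hφ) h
  rcases hu with ⟨h1, h2⟩ | ⟨h1, h2⟩
  · have h1' := hinv h1
    have h2' := hinv h2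
    simp only [_root_.map_one, MulEquiv.map_mul, MulAut.inv_apply_self] at h1' h2'
    exact h1'.not_linked h2'
  · have h1' := hinv h1
    have h2' := hinv h2
    simp only [_root_.map_one, MulEquiv.map_mul, MulAut.inv_apply_self] at h1' h2'
    exact h1'.not_linked' h2'

end RepeatedLetters

section Projection

open FreeGroup

variable {n : ℕ}

lemma conj_mem_Rset {x : FreeGroup (Fin n)} (hx : x ∈ Rset n) (w : FreeGroup (Fin n)) :
    w * x * w⁻¹ ∈ Rset n := by
  obtain ⟨v, i, rfl⟩ := hx
  exact ⟨w * v, i, by simp [mul_assoc]⟩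

lemma of_mem_Rset (i : Fin n) : of i ∈ Rset n := ⟨1, i, by simp⟩

lemma braidAut_mem_Rset {φ : MulAut (FreeGroup (Fin n))} (hφ : φ ∈ braidAuts n)
    {x : FreeGroup (Fin n)} (hx : x ∈ Rset n) : φ x ∈ Rset n := by
  have of_gen : ∀ {ψ : MulAut (FreeGroup (Fin n))}, (∀ k, ψ (of k) ∈ Rset n) →
      ∀ x ∈ Rset n, ψ x ∈ Rset n := by
    rintro ψ hψ _ ⟨w, k, rfl⟩
    rw [MulEquiv.map_mul, MulEquiv.map_mul, MulEquiv.map_inv]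
    exact conj_mem_Rset (hψ k) _
  refine braidAuts_induction (p := fun φ => ∀ x ∈ Rset n, φ x ∈ Rset n) (fun _ h => h)
    ?_ ?_ ?_ hφ x hx
  · intro φ ψ h1 h2 x hx
    exact h1 _ (h2 _ hx)
  · intro i j h hij
    refine of_gen fun k => ?_
    rw [braidAut_apply, braidHom_of]
    split_ifs
    · exact conj_mem_Rset (of_mem_Rset j) _
    · exact of_mem_Rset i
    · exact of_mem_Rset k
  · intro i j h hij
    refine of_gen fun k => ?_
    rw [braidAut_inv_apply, braidInvHom_of]
    split_ifs
    · exact of_mem_Rset j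
    · simpa using conj_mem_Rset (of_mem_Rset i) (of j)⁻¹
    · exact of_mem_Rset k

lemma pr_mem_Refl {x : FreeGroup (Fin n)} (hx : x ∈ Rset n) : pr n x ∈ Refl n := by
  obtain ⟨w, i, rfl⟩ := hx
  exact ⟨pr n w, i, by simp⟩

lemma mul_self_of_mem_Refl {t : UCox n} (ht : t ∈ Refl n) : t * t = 1 := by
  obtain ⟨w, i, rfl⟩ := ht
  calc w * sgen i * w⁻¹ * (w * sgen i * w⁻¹) = w * (sgen i * sgen i) * w⁻¹ := by group
    _ = 1 := by rw [sgen_mul_self]; group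

lemma pr_gElt : pr n (gElt n) = coxElt n := by
  rw [map_gElt]
  simp [coxElt]

/-- Braid automorphisms descend to the universal Coxeter group. -/
lemma pr_braidAut_congr {φ : MulAut (FreeGroup (Fin n))} (hφ : φ ∈ braidAuts n)
    {x y : FreeGroup (Fin n)} (h : pr n x = pr n y) : pr n (φ x) = pr n (φ y) := by
  have key : (coxLift (fun j => pr n (φ (of j))) fun j =>
      mul_self_of_mem_Refl (pr_mem_Refl (braidAut_mem_Rset hφ (of_mem_Rset j)))).comp (pr n) =
      (pr n).comp φ.toMonoidHom := by
    ext j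
    simp
  have hx := DFunLike.congr_fun key x
  have hy := DFunLike.congr_fun key y
  simp only [MonoidHom.comp_apply, h] at hx hy
  exact hx.symm.trans hy

lemma of_inv_not_mem_Rset (i : Fin n) : (of i)⁻¹ ∉ Rset n := by
  rintro ⟨w, k, h⟩
  have := congrArg (lift fun _ : Fin n => Multiplicative.ofAdd (1 : ℤ)) h
  rw [MonoidHom.map_mul, MonoidHom.map_mul, MonoidHom.map_inv, MonoidHom.map_inv, mul_comm,
    inv_mul_cancel_left, lift_apply_of, lift_apply_of, ← ofAdd_neg] at this
  exact absurd (Multiplicative.ofAdd.injective this) (by decide)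

/-- The only image of a generator under a braid automorphism lying over `s_i` is `f_i`. -/
lemma braidAut_of_eq_of_pr_eq {φ : MulAut (FreeGroup (Fin n))} (hφ : φ ∈ braidAuts n)
    {i j : Fin n} (h : pr n (φ (of j)) = sgen i) : φ (of j) = of i := by
  have hw : (φ (of j)).toWord.map Prod.fst = [i] := by
    refine letterSystem_cox.ev_inj _ _
      ((isChain_toWord_braidAut hφ j).imp fun _ _ h => h.symm) (by simp [IsRed]) ?_
    rw [← pr_mk, FreeGroup.mk_toWord, h]
    simp
  obtain ⟨⟨k, b⟩, hb, rfl⟩ := List.map_eq_singleton_iff.1 hw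
  have hx : φ (of j) = FreeGroup.mk [(k, b)] := by rw [← hb, FreeGroup.mk_toWord]
  cases b with
  | true => exact hx
  | false =>
    refine absurd (braidAut_mem_Rset hφ (of_mem_Rset j)) ?_
    rw [hx]
    exact of_inv_not_mem_Rset k

/-- Hurwitz transitivity on `Red_R(g)`. -/
lemma exists_braidAut_of_mem_RedR {t : Fin n → FreeGroup (Fin n)} (ht : t ∈ RedR n) :
    ∃ φ ∈ braidAuts n, ∀ i, t i = φ (of i) :=
  letterSystem_freeGroup.exists_braidAut (fun i => (i, true))
    (fun i j _ h => by simp [flipLetter] at h)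
    (lift fun i => Multiplicative.ofAdd (Pi.single i 1)) (fun i => lift_apply_of)
    (MonoidHom.id _) (fun _ => rfl) t ht.1 ht.2

/-- Hurwitz transitivity on `Red_T(c)`. -/
lemma exists_braidAut_of_mem_RedT {t : Fin n → UCox n} (ht : t ∈ RedT n) :
    ∃ φ ∈ braidAuts n, ∀ i, t i = pr n (φ (of i)) :=
  letterSystem_cox.exists_braidAut id (fun i j h h' => h h'.symm)
    (coxLift (fun i => Multiplicative.ofAdd (Pi.single i 1)) fun i => by
      rw [← ofAdd_add, ← Pi.single_add, CharTwo.add_self_eq_zero (1 : ZMod 2), Pi.single_zero,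
        ofAdd_zero])
    (fun i => coxLift_sgen _ _ _) (pr n) pr_of t ht.1 (by rw [ht.2, pr_gElt])

lemma braidAut_mem_RedR {φ : MulAut (FreeGroup (Fin n))} (hφ : φ ∈ braidAuts n) :
    (fun i => φ (of i)) ∈ RedR n :=
  ⟨fun i => braidAut_mem_Rset hφ (of_mem_Rset i),
    (map_gElt φ.toMonoidHom).symm.trans (braidAuts_gElt hφ)⟩

lemma pr_comp_mem_RedT {t : Fin n → FreeGroup (Fin n)} (ht : t ∈ RedR n) :
    (fun i => pr n (t i)) ∈ RedT n := by
  refine ⟨fun i => pr_mem_Refl (ht.1 i), ?_⟩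
  rw [← pr_gElt, ← ht.2, map_list_prod, List.map_ofFn]
  rfl

end Projection

/-- `π` induces a bijection from `R_g` (entries of tuples in `Red_R(g)`)
onto `T_c` (entries of tuples in `Red_T(c)`). -/
theorem projection_bijOn_Rg_Tc (n : ℕ) :
    Set.BijOn (pr n)
      { r | ∃ t ∈ RedR n, ∃ i, t i = r }
      { s | ∃ t ∈ RedT n, ∃ i, t i = s } := by
  refine ⟨?_, ?_, ?_⟩
  · rintro _ ⟨t, ht, i, rfl⟩
    exact ⟨_, pr_comp_mem_RedT ht, i, rfl⟩
  · rintro _ ⟨t, ht, i, rfl⟩ _ ⟨t', ht', j, rfl⟩ h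
    obtain ⟨φ, hφ, hφt⟩ := exists_braidAut_of_mem_RedR ht
    obtain ⟨ψ, hψ, hψt⟩ := exists_braidAut_of_mem_RedR ht'
    rw [hφt, hψt] at h ⊢
    have hpr := pr_braidAut_congr (inv_mem hφ) h
    rw [MulAut.inv_apply_self, pr_of] at hpr
    have := braidAut_of_eq_of_pr_eq (mul_mem (inv_mem hφ) hψ) hpr.symm
    rw [← this, MulAut.mul_apply, MulAut.apply_inv_self]
  · rintro _ ⟨t, ht, i, rfl⟩
    obtain ⟨φ, hφ, hφt⟩ := exists_braidAut_of_mem_RedT ht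
    exact ⟨φ (FreeGroup.of i), ⟨_, braidAut_mem_RedR hφ, i, rfl⟩, (hφt i).symm⟩
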